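/- arXiv:math/0504456 — 8 statements merged into one kernel-verified Lean document; each statement's English description precedes it below -/
import Mathlib

section
/- Let μ be a finite positive Borel measure on (0,∞) such that the image measure τ_q(μ) is absolutely continuous with respect to μ with dτ_q(μ)/dμ(x) = 1/x for μ-almost every x. Then for every n ∈ ℤ the image measure τ_{q^n}(μ) is absolutely continuous with respect to μ with dτ_{q^n}(μ)/dμ(x) = q^{n(n-1)/2}·x^{-n} for μ-almost every x. In particular, x^n is μ-integrable for every n ∈ ℤ, and if μ is a probability measure then ∫_0^∞ x^n dμ(x) = q^{-n(n+1)/2} for all n ∈ ℤ. -/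
open MeasureTheory Filter Set

/-- The density `q^{n(n-1)/2} x^{-n}` of the image of the measure under `x ↦ q^n x`. -/
noncomputable def scaleDensity (q : ℝ) (n : ℤ) (x : ℝ) : ENNReal :=
  ENNReal.ofReal (q ^ (n * (n - 1) / 2) / x ^ n)

lemma measurable_scaleDensity (q : ℝ) (n : ℤ) : Measurable (scaleDensity q n) := by
  unfold scaleDensity
  fun_prop

lemma triangular_add (m n : ℤ) :
    (m + n) * (m + n - 1) / 2 = m * (m - 1) / 2 + n * (n - 1) / 2 + m * n := by
  have h (k : ℤ) : 2 * (k * (k - 1) / 2) = k * (k - 1) :=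
    Int.mul_ediv_cancel' (Int.even_mul_pred_self k).two_dvd
  have h1 := h m
  have h2 := h n
  have h3 := h (m + n)
  refine mul_left_cancel₀ (two_ne_zero : (2 : ℤ) ≠ 0) ?_
  rw [mul_add, mul_add, h1, h2, h3]
  ring

lemma scaleDensity_cocycle {q : ℝ} (hq : 0 < q) (m n : ℤ) {x : ℝ} (hx : 0 < x) :
    scaleDensity q m x * scaleDensity q n (q ^ (-m) * x) = scaleDensity q (m + n) x := by
  unfold scaleDensity
  rw [← ENNReal.ofReal_mul (by positivity), triangular_add, zpow_add₀ hq.ne',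
    zpow_add₀ hq.ne', zpow_add₀ hx.ne', mul_zpow, ← zpow_mul, neg_mul, zpow_neg]
  congr 1
  field_simp

lemma scaleDensity_one (q x : ℝ) : scaleDensity q 1 x = ENNReal.ofReal (1 / x) := by
  simp [scaleDensity]

lemma scaleDensity_neg_one (q x : ℝ) : scaleDensity q (-1) x = ENNReal.ofReal (q * x) := by
  simp [scaleDensity]

/-- The image of `μ` under `x ↦ q^n x` has density `scaleDensity q n`, in integral form. -/
def HasScaleDensity (q : ℝ) (μ : Measure ℝ) (n : ℤ) : Prop :=
  ∀ g : ℝ → ENNReal, Measurable g →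
    ∫⁻ x, g (q ^ n * x) ∂μ = ∫⁻ x, scaleDensity q n x * g x ∂μ

namespace HasScaleDensity

variable {q : ℝ} {μ : Measure ℝ} {m n : ℤ}

lemma zero : HasScaleDensity q μ 0 := by
  intro g _
  simp [scaleDensity]

lemma add (hq : 0 < q) (hpos : ∀ᵐ x ∂μ, 0 < x)
    (hm : HasScaleDensity q μ m) (hn : HasScaleDensity q μ n) :
    HasScaleDensity q μ (m + n) := by
  intro g hg
  have hd := measurable_scaleDensity q n
  calc ∫⁻ x, g (q ^ (m + n) * x) ∂μ = ∫⁻ x, g (q ^ m * (q ^ n * x)) ∂μ := by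
        simp only [zpow_add₀ hq.ne', mul_assoc]
    _ = ∫⁻ x, scaleDensity q n x * g (q ^ m * x) ∂μ :=
        hn (fun x => g (q ^ m * x)) (by fun_prop)
    _ = ∫⁻ x, scaleDensity q n (q ^ (-m) * (q ^ m * x)) * g (q ^ m * x) ∂μ := by
        have h (x : ℝ) : q ^ (-m) * (q ^ m * x) = x := by
          rw [← mul_assoc, ← zpow_add₀ hq.ne']
          simp
        simp only [h]
    _ = ∫⁻ x, scaleDensity q m x * (scaleDensity q n (q ^ (-m) * x) * g x) ∂μ :=
        hm (fun x => scaleDensity q n (q ^ (-m) * x) * g x) (by fun_prop)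
    _ = ∫⁻ x, scaleDensity q (m + n) x * g x ∂μ := by
        refine lintegral_congr_ae ?_
        filter_upwards [hpos] with x hx
        rw [← mul_assoc, scaleDensity_cocycle hq m n hx]

lemma neg_one (hq : 0 < q) (hpos : ∀ᵐ x ∂μ, 0 < x) (h : HasScaleDensity q μ 1) :
    HasScaleDensity q μ (-1) := by
  intro g hg
  have h1 := h (fun x => ENNReal.ofReal x * g (q ^ (-1 : ℤ) * x)) (by fun_prop)
  have h2 (x : ℝ) : q ^ (-1 : ℤ) * (q ^ (1 : ℤ) * x) = x := by
    rw [← mul_assoc, ← zpow_add₀ hq.ne']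
    simp
  simp only [h2] at h1
  simp only [scaleDensity_neg_one]
  rw [zpow_one] at h1
  rw [h1]
  refine lintegral_congr_ae ?_
  filter_upwards [hpos] with x hx
  rw [scaleDensity_one, ← mul_assoc, ← ENNReal.ofReal_mul (by positivity),
    one_div_mul_cancel hx.ne', ENNReal.ofReal_one, one_mul]

lemma of_one (hq : 0 < q) (hpos : ∀ᵐ x ∂μ, 0 < x) (h : HasScaleDensity q μ 1) (n : ℤ) :
    HasScaleDensity q μ n := by
  induction n using Int.induction_on with
  | zero => exact zero
  | succ k ih => exact ih.add hq hpos h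
  | pred k ih => exact ih.add hq hpos (h.neg_one hq hpos)

lemma map_eq (h : HasScaleDensity q μ n) :
    Measure.map (fun x => q ^ n * x) μ = μ.withDensity (scaleDensity q n) := by
  refine Measure.ext_of_lintegral _ fun g hg => ?_
  rw [lintegral_map hg (by fun_prop), h g hg,
    lintegral_withDensity_eq_lintegral_mul _ (measurable_scaleDensity q n) hg]
  rfl

lemma lintegral_scaleDensity (h : HasScaleDensity q μ n) :
    ∫⁻ x, scaleDensity q n x ∂μ = μ univ := by
  simpa using (h (fun _ => 1) measurable_const).symm

lemma lintegral_zpow (hq : 0 < q) (hpos : ∀ᵐ x ∂μ, 0 < x) (h : HasScaleDensity q μ (-n)) :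
    ∫⁻ x, ENNReal.ofReal (x ^ n) ∂μ = ENNReal.ofReal (q ^ (-(n * (n + 1) / 2))) * μ univ := by
  rw [← h.lintegral_scaleDensity, ← lintegral_const_mul _ (measurable_scaleDensity q _)]
  refine lintegral_congr_ae ?_
  filter_upwards [hpos] with x hx
  have he : -n * (-n - 1) / 2 = n * (n + 1) / 2 := by
    congr 1
    ring
  rw [scaleDensity, ← ENNReal.ofReal_mul (by positivity), he, zpow_neg, zpow_neg]
  congr 1
  field_simp

end HasScaleDensity

/-- let `μ` be a finite positive Borel measure on `(0,∞)` with
`τ_q(μ) ≪ μ` and `dτ_q(μ)/dμ = 1/x` μ-a.e. Then for every `n ∈ ℤ` the image measure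
`τ_{q^n}(μ)` is absolutely continuous with respect to `μ` with
`dτ_{q^n}(μ)/dμ = q^{n(n-1)/2} x^{-n}` μ-a.e.; in particular `x^n` is μ-integrable for
every `n ∈ ℤ`, and if `μ` is a probability measure then
`∫ x^n dμ = q^{-n(n+1)/2}` for all `n ∈ ℤ`. -/
theorem image_measures_and_moments (q : ℝ) (hq0 : 0 < q) (hq1 : q < 1)
    (μ : Measure ℝ) [IsFiniteMeasure μ] (hsupp : μ (Set.Ioi (0 : ℝ))ᶜ = 0)
    (hac : Measure.map (fun x => q * x) μ ≪ μ)
    (hrn : (Measure.map (fun x => q * x) μ).rnDeriv μ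
      =ᵐ[μ] fun x => ENNReal.ofReal (1 / x)) :
    (∀ n : ℤ,
      Measure.map (fun x => q ^ n * x) μ ≪ μ ∧
      (Measure.map (fun x => q ^ n * x) μ).rnDeriv μ
        =ᵐ[μ] (fun x => ENNReal.ofReal (q ^ (n * (n - 1) / 2) / x ^ n)) ∧
      Integrable (fun x : ℝ => x ^ n) μ) ∧
    (IsProbabilityMeasure μ →
      ∀ n : ℤ, ∫ x, x ^ n ∂μ = q ^ (-(n * (n + 1) / 2))) := by
  have hpos : ∀ᵐ x ∂μ, 0 < x := hsupp
  have h_one : HasScaleDensity q μ 1 := by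
    intro g hg
    have hmap : Measure.map (fun x => q * x) μ = μ.withDensity (scaleDensity q 1) := by
      rw [← Measure.withDensity_rnDeriv_eq _ _ hac]
      refine withDensity_congr_ae ?_
      filter_upwards [hrn] with x hx
      rw [hx, scaleDensity_one]
    simp only [zpow_one]
    rw [← lintegral_map hg (by fun_prop : Measurable fun x : ℝ => q * x), hmap,
      lintegral_withDensity_eq_lintegral_mul _ (measurable_scaleDensity q 1) hg]
    rfl
  have h_all := h_one.of_one hq0 hpos
  have h_nonneg (n : ℤ) : 0 ≤ᵐ[μ] fun x : ℝ => x ^ n := by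
    filter_upwards [hpos] with x hx
    exact (zpow_pos hx n).le
  have h_meas (n : ℤ) : AEStronglyMeasurable (fun x : ℝ => x ^ n) μ := by
    have h : Measurable fun x : ℝ => x ^ n := by fun_prop
    exact h.aestronglyMeasurable
  refine ⟨fun n => ⟨?_, ?_, ?_⟩, fun _ n => ?_⟩
  · rw [(h_all n).map_eq]
    exact withDensity_absolutelyContinuous _ _
  · rw [(h_all n).map_eq]
    exact Measure.rnDeriv_withDensity _ (measurable_scaleDensity q n)
  · refine ⟨h_meas n, ?_⟩
    rw [hasFiniteIntegral_iff_ofReal (h_nonneg n), (h_all (-n)).lintegral_zpow hq0 hpos]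
    exact ENNReal.mul_lt_top ENNReal.ofReal_lt_top (measure_lt_top μ univ)
  · rw [integral_eq_lintegral_of_nonneg_ae (h_nonneg n) (h_meas n),
      (h_all (-n)).lintegral_zpow hq0 hpos, measure_univ, mul_one,
      ENNReal.toReal_ofReal (zpow_pos hq0 _).le]
end

section
/- For all a, y ∈ ℂ the function f(y) = ₁φ₁(a; 0; q, y) satisfies the second order q-difference equation -a·y·f(qy) + (y - q)·f(y) + q·f(y/q) = 0 (at y = 0 the term f(y/q) is interpreted via the same entire function). -/
open Finset

/-- The q-Pochhammer symbol `(a;q)_n = ∏_{j=0}^{n-1} (1 - a q^j)`. -/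
noncomputable def qPoch (q a : ℂ) (n : ℕ) : ℂ :=
  ∏ j ∈ Finset.range n, (1 - a * q ^ j)

/-- The basic hypergeometric series `₁φ₁(a; 0; q, y)`. -/
noncomputable def onePhiOne (q a y : ℂ) : ℂ :=
  ∑' n : ℕ, (qPoch q a n / qPoch q q n) * (-1) ^ n * q ^ (n * (n - 1) / 2) * y ^ n

open Filter Topology in
/-- A power series whose coefficients satisfy `c (n + 1) = r n * c n` with `r n → 0` converges
everywhere. -/
theorem summable_mul_pow_of_ratio_tendsto_zero {c r : ℕ → ℂ} (hc : ∀ n, c (n + 1) = r n * c n)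
    (hr : Tendsto r atTop (𝓝 0)) (y : ℂ) : Summable fun n => c n * y ^ n := by
  have hry : Tendsto (fun n => ‖r n * y‖) atTop (𝓝 0) := by
    simpa using (hr.mul_const y).norm
  refine summable_of_ratio_norm_eventually_le (r := 1 / 2) (by norm_num) ?_
  filter_upwards [hry.eventually_le_const (show (0 : ℝ) < 1 / 2 by norm_num)] with n hn
  rw [hc, show r n * c n * y ^ (n + 1) = (r n * y) * (c n * y ^ n) by ring, norm_mul]
  gcongr

/-- The coefficient of `y ^ n` in `₁φ₁(a; 0; q, y)`. -/
noncomputable def onePhiOneCoeff (q a : ℂ) (n : ℕ) : ℂ :=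
  (qPoch q a n / qPoch q q n) * (-1) ^ n * q ^ (n * (n - 1) / 2)

theorem onePhiOneCoeff_succ (q a : ℂ) (n : ℕ) :
    onePhiOneCoeff q a (n + 1) =
      (-((1 - a * q ^ n) / (1 - q ^ (n + 1)) * q ^ n)) * onePhiOneCoeff q a n := by
  simp only [onePhiOneCoeff, qPoch, Finset.prod_range_succ, Nat.triangle_succ, mul_div_mul_comm,
    pow_succ' q n]
  ring

open Filter Topology in
theorem summable_onePhiOne {q : ℂ} (hq : ‖q‖ < 1) (a y : ℂ) :
    Summable fun n => onePhiOneCoeff q a n * y ^ n := by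
  refine summable_mul_pow_of_ratio_tendsto_zero (onePhiOneCoeff_succ q a) ?_ y
  have hpow := tendsto_pow_atTop_nhds_zero_of_norm_lt_one hq
  have hnum : Tendsto (fun n => 1 - a * q ^ n) atTop (𝓝 1) := by
    simpa using (hpow.const_mul a).const_sub 1
  have hden : Tendsto (fun n => 1 - q ^ (n + 1)) atTop (𝓝 1) := by
    simpa using ((tendsto_add_atTop_iff_nat 1).2 hpow).const_sub 1
  simpa using ((hnum.div hden one_ne_zero).mul hpow).neg

/-- for `0 < q < 1`, the function `f(y) = ₁φ₁(a;0;q,y)` satisfies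
`-a y f(qy) + (y - q) f(y) + q f(y/q) = 0` for all `a, y ∈ ℂ`. -/
theorem onePhiOne_q_difference_equation (q : ℝ) (hq0 : 0 < q) (hq1 : q < 1)
    (a y : ℂ) :
    -a * y * onePhiOne q a (q * y) + (y - q) * onePhiOne q a y
      + q * onePhiOne q a (y / q) = 0 := by
  have hnorm : ‖(q : ℂ)‖ < 1 := by simpa [abs_of_pos hq0] using hq1
  have hq : (q : ℂ) ≠ 0 := by exact_mod_cast hq0.ne'
  have hden (n : ℕ) : (1 : ℂ) - (q : ℂ) ^ (n + 1) ≠ 0 := by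
    have := (pow_lt_one₀ hq0.le hq1 n.succ_ne_zero).ne'
    exact sub_ne_zero.2 (by exact_mod_cast this)
  have hs := summable_onePhiOne hnorm a
  have hsum (z : ℂ) :
      HasSum (fun n => onePhiOneCoeff q a n * z ^ n) (onePhiOne q a z) := (hs z).hasSum
  have hsucc (z : ℂ) : HasSum (fun n => onePhiOneCoeff q a (n + 1) * z ^ (n + 1))
      (onePhiOne q a z - onePhiOneCoeff q a 0) := by
    simpa using (hasSum_nat_add_iff' 1).2 (hsum z)
  have h := ((((hsum (q * y)).mul_left (-a * y)).add ((hsum y).mul_left y)).sub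
    ((hsucc y).mul_left (q : ℂ))).add ((hsucc (y / q)).mul_left (q : ℂ))
  have hzero (n : ℕ) : -a * y * (onePhiOneCoeff q a n * (q * y) ^ n)
      + y * (onePhiOneCoeff q a n * y ^ n) - q * (onePhiOneCoeff q a (n + 1) * y ^ (n + 1))
      + q * (onePhiOneCoeff q a (n + 1) * (y / q) ^ (n + 1)) = 0 := by
    have := hden n
    rw [onePhiOneCoeff_succ, div_pow, mul_pow]
    field_simp
    ring
  simp only [hzero] at h
  linear_combination h.unique hasSum_zero
end

section
/- For every z ∈ ℂ and every x ∈ ℂ with x ≠ 0, the function φ_z satisfies the eigenvalue equation (Lφ_z)(x) = z·φ_z(x), that is, φ_z(qx) - φ_z(x)/x + φ_z(x/q)/x = z·φ_z(x). -/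
open Finset

/-- The eigenfunction `φ_z(x) = Σ_{n=0}^∞ (∏_{j=0}^{n-1} (z - q^j)) q^{n(n+1)/2} x^n/(q;q)_n`. -/
noncomputable def phiSW (q z x : ℂ) : ℂ :=
  ∑' n : ℕ, (∏ j ∈ Finset.range n, (z - q ^ j)) * q ^ (n * (n + 1) / 2) * x ^ n / qPoch q q n


open Filter Topology in
/-- A power series whose coefficients satisfy the recurrence of those of `phiSW q z` converges
everywhere. -/
theorem summable_mul_pow_of_recurrence {q z : ℂ} (hq : ‖q‖ < 1) {c : ℕ → ℂ}
    (hc : ∀ n, c (n + 1) = c n * ((z - q ^ n) * q ^ (n + 1) / (1 - q ^ (n + 1)))) (x : ℂ) :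
    Summable fun n ↦ c n * x ^ n := by
  have hpow : Tendsto (fun n : ℕ ↦ q ^ n) atTop (𝓝 0) :=
    tendsto_pow_atTop_nhds_zero_of_norm_lt_one hq
  have hpow' : Tendsto (fun n : ℕ ↦ q ^ (n + 1)) atTop (𝓝 0) :=
    (tendsto_add_atTop_iff_nat 1).2 hpow
  have hratio : Tendsto (fun n : ℕ ↦ ‖(z - q ^ n) * q ^ (n + 1) / (1 - q ^ (n + 1)) * x‖)
      atTop (𝓝 0) := by
    have h := ((((tendsto_const_nhds (x := z)).sub hpow).mul hpow').div
      ((tendsto_const_nhds (x := (1 : ℂ))).sub hpow') (by simp)).mul_const x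
    simpa using h.norm
  refine summable_of_ratio_norm_eventually_le (r := 1 / 2) (by norm_num) ?_
  filter_upwards [hratio.eventually_le_const (by norm_num : (0 : ℝ) < 1 / 2)] with n hn
  calc ‖c (n + 1) * x ^ (n + 1)‖
      = ‖(z - q ^ n) * q ^ (n + 1) / (1 - q ^ (n + 1)) * x‖ * ‖c n * x ^ n‖ := by
        rw [← norm_mul, hc, pow_succ x]
        congr 1
        ring
    _ ≤ 1 / 2 * ‖c n * x ^ n‖ := by gcongr

/-- The coefficient of `x ^ n` in the series defining `phiSW q z x`. -/
noncomputable def phiSWCoeff (q z : ℂ) (n : ℕ) : ℂ :=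
  (∏ j ∈ Finset.range n, (z - q ^ j)) * q ^ (n * (n + 1) / 2) / qPoch q q n

theorem phiSW_eq_tsum (q z x : ℂ) : phiSW q z x = ∑' n, phiSWCoeff q z n * x ^ n :=
  tsum_congr fun n ↦ by rw [phiSWCoeff]; ring

theorem phiSWCoeff_succ (q z : ℂ) (n : ℕ) :
    phiSWCoeff q z (n + 1) =
      phiSWCoeff q z n * ((z - q ^ n) * q ^ (n + 1) / (1 - q ^ (n + 1))) := by
  have hexp : (n + 1) * (n + 1 + 1) / 2 = n * (n + 1) / 2 + (n + 1) := by
    rw [show (n + 1) * (n + 1 + 1) = n * (n + 1) + (n + 1) * 2 by ring,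
      Nat.add_mul_div_right _ _ two_pos]
  simp only [phiSWCoeff, qPoch, Finset.prod_range_succ, hexp, pow_add q (n * (n + 1) / 2),
    ← pow_succ']
  rw [← mul_div_mul_comm]
  ring

theorem hasSum_phiSW {q : ℂ} (hq : ‖q‖ < 1) (z x : ℂ) :
    HasSum (fun n ↦ phiSWCoeff q z n * x ^ n) (phiSW q z x) :=
  phiSW_eq_tsum q z x ▸ (summable_mul_pow_of_recurrence hq (phiSWCoeff_succ q z) x).hasSum

/-- for `0 < q < 1`, every `z ∈ ℂ` and every `x ≠ 0`, the function `φ_z`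
satisfies the eigenvalue equation `φ_z(qx) - φ_z(x)/x + φ_z(x/q)/x = z φ_z(x)`. -/
theorem phiSW_eigenvalue_equation (q : ℝ) (hq0 : 0 < q) (hq1 : q < 1)
    (z : ℂ) (x : ℂ) (hx : x ≠ 0) :
    phiSW q z (q * x) - phiSW q z x / x + phiSW q z (x / q) / x = z * phiSW q z x := by
  have hq : (q : ℂ) ≠ 0 := by exact_mod_cast hq0.ne'
  have hnorm : ‖(q : ℂ)‖ < 1 := by simpa [abs_of_pos hq0] using hq1
  have hne (n : ℕ) : 1 - (q : ℂ) ^ (n + 1) ≠ 0 := by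
    have : 1 - q ^ (n + 1) ≠ 0 := (sub_pos.2 (pow_lt_one₀ hq0.le hq1 n.succ_ne_zero)).ne'
    exact_mod_cast this
  have hdiff := (hasSum_phiSW hnorm z (x / q)).sub (hasSum_phiSW hnorm z x)
  rw [← hasSum_nat_add_iff' 1] at hdiff
  have heigen := (((hasSum_phiSW hnorm z x).mul_left z).sub
    (hasSum_phiSW hnorm z (q * x))).mul_left x
  have key := hdiff.unique (heigen.congr_fun fun n ↦ by
    have := hne n
    rw [phiSWCoeff_succ, div_pow, mul_pow]
    field_simp
    ring)
  simp only [Finset.sum_range_one, pow_zero, sub_self, sub_zero] at key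
  field_simp
  linear_combination key
end

section
/- For every n ∈ ℕ and every x ∈ ℂ with x ≠ 0, the Stieltjes–Wigert polynomial S_n(·;q) satisfies the eigenvalue equation (L S_n(·;q))(x) = q^n·S_n(x;q), that is, S_n(qx;q) - S_n(x;q)/x + S_n(x/q;q)/x = q^n·S_n(x;q). -/
open Finset

/-- The Stieltjes--Wigert polynomial
`S_n(x;q) = (1/(q;q)_n) Σ_{k=0}^n ((q;q)_n/((q;q)_k (q;q)_{n-k})) (-1)^k q^{k²} x^k`. -/
noncomputable def stieltjesWigert (q : ℂ) (n : ℕ) (x : ℂ) : ℂ :=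
  (1 / qPoch q q n) *
    ∑ k ∈ Finset.range (n + 1),
      (qPoch q q n / (qPoch q q k * qPoch q q (n - k))) * (-1) ^ k * q ^ (k ^ 2) * x ^ k

theorem qPoch_succ (q a : ℂ) (n : ℕ) : qPoch q a (n + 1) = qPoch q a n * (1 - a * q ^ n) :=
  Finset.prod_range_succ _ _

theorem one_sub_ofReal_pow_succ_ne_zero {q : ℝ} (hq0 : 0 < q) (hq1 : q < 1) (j : ℕ) :
    1 - (q : ℂ) * (q : ℂ) ^ j ≠ 0 := by
  have h : q * q ^ j < 1 := by
    simpa [pow_succ'] using pow_lt_one₀ hq0.le hq1 j.succ_ne_zero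
  exact_mod_cast (sub_pos.mpr h).ne'

theorem qPoch_self_ne_zero {q : ℝ} (hq0 : 0 < q) (hq1 : q < 1) (n : ℕ) : qPoch q q n ≠ 0 :=
  Finset.prod_ne_zero_iff.mpr fun j _ => one_sub_ofReal_pow_succ_ne_zero hq0 hq1 j

/-- The coefficient of `x ^ k` in `stieltjesWigert q n x`, for `k ≤ n`. -/
noncomputable def stieltjesWigertCoeff (q : ℂ) (n k : ℕ) : ℂ :=
  (-1) ^ k * q ^ (k ^ 2) / (qPoch q q k * qPoch q q (n - k))

theorem stieltjesWigert_eq_sum {q : ℂ} {n : ℕ} (h : qPoch q q n ≠ 0) (x : ℂ) :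
    stieltjesWigert q n x = ∑ k ∈ Finset.range (n + 1), stieltjesWigertCoeff q n k * x ^ k := by
  rw [stieltjesWigert, Finset.mul_sum]
  refine Finset.sum_congr rfl fun k _ => ?_
  rw [stieltjesWigertCoeff]
  field_simp

theorem stieltjesWigertCoeff_succ {q : ℝ} (hq0 : 0 < q) (hq1 : q < 1) {n k : ℕ} (hk : k < n) :
    (((q : ℂ) ^ (k + 1))⁻¹ - 1) * stieltjesWigertCoeff q n (k + 1) =
      ((q : ℂ) ^ n - (q : ℂ) ^ k) * stieltjesWigertCoeff q n k := by
  obtain ⟨m, rfl⟩ : ∃ m, n = k + m + 1 := ⟨n - k - 1, by omega⟩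
  have hq : (q : ℂ) ≠ 0 := by exact_mod_cast hq0.ne'
  have hPk := qPoch_self_ne_zero hq0 hq1 k
  have hPm := qPoch_self_ne_zero hq0 hq1 m
  have hk := one_sub_ofReal_pow_succ_ne_zero hq0 hq1 k
  have hm := one_sub_ofReal_pow_succ_ne_zero hq0 hq1 m
  rw [stieltjesWigertCoeff, stieltjesWigertCoeff, show k + m + 1 - (k + 1) = m by omega,
    show k + m + 1 - k = m + 1 by omega, qPoch_succ, qPoch_succ]
  field_simp
  ring

/-- for `0 < q < 1`, every `n ∈ ℕ` and every `x ≠ 0`, the Stieltjes--Wigert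
polynomial satisfies `S_n(qx;q) - S_n(x;q)/x + S_n(x/q;q)/x = q^n S_n(x;q)`. -/
theorem stieltjesWigert_eigenvalue_equation (q : ℝ) (hq0 : 0 < q) (hq1 : q < 1)
    (n : ℕ) (x : ℂ) (hx : x ≠ 0) :
    stieltjesWigert q n (q * x) - stieltjesWigert q n x / x
      + stieltjesWigert q n (x / q) / x = (q : ℂ) ^ n * stieltjesWigert q n x := by
  simp only [stieltjesWigert_eq_sum (qPoch_self_ne_zero hq0 hq1 n)]
  have lower : ∑ k ∈ Finset.range (n + 1),
        (((q : ℂ) ^ k)⁻¹ - 1) * stieltjesWigertCoeff q n k * x ^ k / x =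
      ∑ k ∈ Finset.range (n + 1),
        ((q : ℂ) ^ n - (q : ℂ) ^ k) * stieltjesWigertCoeff q n k * x ^ k := by
    rw [Finset.sum_range_succ', Finset.sum_range_succ]
    simp only [pow_zero, inv_one, sub_self, zero_mul, zero_div, add_zero]
    refine Finset.sum_congr rfl fun k hk => ?_
    rw [stieltjesWigertCoeff_succ hq0 hq1 (Finset.mem_range.mp hk), pow_succ x]
    field_simp
  have expand : ∑ k ∈ Finset.range (n + 1),
        (((q : ℂ) ^ k)⁻¹ - 1) * stieltjesWigertCoeff q n k * x ^ k / x =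
      (∑ k ∈ Finset.range (n + 1), stieltjesWigertCoeff q n k * (x / q) ^ k) / x -
        (∑ k ∈ Finset.range (n + 1), stieltjesWigertCoeff q n k * x ^ k) / x := by
    rw [Finset.sum_div, Finset.sum_div, ← Finset.sum_sub_distrib]
    refine Finset.sum_congr rfl fun k _ => ?_
    rw [div_pow]
    ring
  rw [sub_add_eq_add_sub, add_sub_assoc, ← expand, lower, ← Finset.sum_add_distrib,
    Finset.mul_sum]
  refine Finset.sum_congr rfl fun k _ => ?_
  rw [mul_pow]
  ring
end

section
/- For z ∈ ℂ with z ∉ (-∞,0] and x > 0, define Φ_z(x) = exp((log x)·(Log z)/(log q))·₁φ₁(1/z; 0; q, -q/(xz)), where Log is the principal branch of the complex logarithm. Then Φ_z satisfies the eigenvalue equation (LΦ_z)(x) = z·Φ_z(x) for all x > 0, that is, Φ_z(qx) - Φ_z(x)/x + Φ_z(x/q)/x = z·Φ_z(x). -/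
open Finset

/-- The eigenfunction `Φ_z(x) = exp((log x)(Log z)/(log q)) ₁φ₁(1/z; 0; q, -q/(xz))`
for `x > 0`, where `Log` is the principal branch of the complex logarithm. -/
noncomputable def PhiSW (q : ℝ) (z : ℂ) (x : ℝ) : ℂ :=
  Complex.exp ((Real.log x) * Complex.log z / (Real.log q)) *
    onePhiOne q (1 / z) (-(q : ℂ) / ((x : ℂ) * z))

/-- The general term of the series `onePhiOne q a y`. -/
noncomputable def onePhiOneTerm (q a y : ℂ) (n : ℕ) : ℂ :=
  (qPoch q a n / qPoch q q n) * (-1) ^ n * q ^ (n * (n - 1) / 2) * y ^ n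

lemma one_sub_pow_succ_ne_zero {q : ℂ} (hq : ‖q‖ < 1) (n : ℕ) : 1 - q ^ (n + 1) ≠ 0 := by
  intro h
  have h1 : ‖q ^ (n + 1)‖ = 1 := by rw [← sub_eq_zero.mp h, norm_one]
  rw [norm_pow] at h1
  exact (pow_lt_one₀ (norm_nonneg q) hq n.succ_ne_zero).ne h1

lemma onePhiOneTerm_succ (q a y : ℂ) (n : ℕ) :
    onePhiOneTerm q a y (n + 1) =
      -((1 - a * q ^ n) / (1 - q ^ (n + 1)) * q ^ n * y) * onePhiOneTerm q a y n := by
  have hn : (n + 1) * (n + 1 - 1) / 2 = n * (n - 1) / 2 + n := by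
    rw [← Finset.sum_range_id_mul_two, ← Finset.sum_range_id_mul_two,
      Nat.mul_div_cancel _ two_pos, Nat.mul_div_cancel _ two_pos, Finset.sum_range_succ]
  have hs : qPoch q q (n + 1) = qPoch q q n * (1 - q ^ (n + 1)) := by
    rw [qPoch, Finset.prod_range_succ, pow_succ']
    rfl
  have ha : qPoch q a (n + 1) = qPoch q a n * (1 - a * q ^ n) := Finset.prod_range_succ _ _
  rw [onePhiOneTerm, onePhiOneTerm, hn, hs, ha, mul_div_mul_comm, pow_add, pow_succ, pow_succ]
  ring

lemma onePhiOneTerm_mul (q a y c : ℂ) (n : ℕ) :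
    onePhiOneTerm q a (c * y) n = c ^ n * onePhiOneTerm q a y n := by
  rw [onePhiOneTerm, onePhiOneTerm, mul_pow]
  ring

lemma summable_onePhiOneTerm {q : ℂ} (hq : ‖q‖ < 1) (a y : ℂ) :
    Summable (onePhiOneTerm q a y) := by
  have hpow := tendsto_pow_atTop_nhds_zero_of_norm_lt_one hq
  have hlim : Filter.Tendsto
      (fun n : ℕ ↦ ‖-((1 - a * q ^ n) / (1 - q ^ (n + 1)) * q ^ n * y)‖)
      Filter.atTop (nhds 0) := by
    have hnum := (hpow.const_mul a).const_sub 1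
    have hden := (hpow.comp (Filter.tendsto_add_atTop_nat 1)).const_sub 1
    simpa using (((hnum.div hden (by simp)).mul hpow).mul_const y).neg.norm
  refine summable_of_ratio_norm_eventually_le (r := 1 / 2) (by norm_num) ?_
  filter_upwards [hlim.eventually_le_const (by norm_num : (0 : ℝ) < 1 / 2)] with n hn
  rw [onePhiOneTerm_succ, norm_mul]
  gcongr

/-- The `q`-difference equation of `₁φ₁(a; 0; q, y)`. -/
lemma onePhiOne_q_difference {q : ℂ} (hq0 : q ≠ 0) (hq : ‖q‖ < 1) (a y : ℂ) :
    onePhiOne q a (q⁻¹ * y) - onePhiOne q a y =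
      -(y / q) * (onePhiOne q a y - a * onePhiOne q a (q * y)) := by
  have hs := summable_onePhiOneTerm hq a
  change ∑' n, onePhiOneTerm q a (q⁻¹ * y) n - ∑' n, onePhiOneTerm q a y n =
    -(y / q) * (∑' n, onePhiOneTerm q a y n - a * ∑' n, onePhiOneTerm q a (q * y) n)
  rw [← (hs _).tsum_sub (hs _), ← tsum_mul_left, ← (hs _).tsum_sub ((hs _).mul_left a),
    ← tsum_mul_left, ((hs _).sub (hs _)).tsum_eq_zero_add]
  have h0 : onePhiOneTerm q a (q⁻¹ * y) 0 - onePhiOneTerm q a y 0 = 0 := by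
    simp [onePhiOneTerm]
  rw [h0, zero_add]
  refine tsum_congr fun n ↦ ?_
  rw [onePhiOneTerm_mul, onePhiOneTerm_mul, onePhiOneTerm_succ]
  have h1 := one_sub_pow_succ_ne_zero hq n
  rw [inv_pow]
  field_simp
  ring

/-- for `0 < q < 1` and `z ∈ ℂ ∖ (-∞,0]`, the function `Φ_z` satisfies the
eigenvalue equation `Φ_z(qx) - Φ_z(x)/x + Φ_z(x/q)/x = z Φ_z(x)` for all `x > 0`. -/
theorem PhiSW_eigenvalue_equation (q : ℝ) (hq0 : 0 < q) (hq1 : q < 1)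
    (z : ℂ) (hz : ¬(z.im = 0 ∧ z.re ≤ 0)) (x : ℝ) (hx : 0 < x) :
    PhiSW q z (q * x) - PhiSW q z x / (x : ℂ) + PhiSW q z (x / q) / (x : ℂ)
      = z * PhiSW q z x := by
  have hz0 : z ≠ 0 := by
    rintro rfl
    simp at hz
  have hqc : (q : ℂ) ≠ 0 := by exact_mod_cast hq0.ne'
  have hxc : (x : ℂ) ≠ 0 := by exact_mod_cast hx.ne'
  have hlog : (Real.log q : ℂ) ≠ 0 := by exact_mod_cast (Real.log_neg hq0 hq1).ne
  have hnorm : ‖(q : ℂ)‖ < 1 := by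
    rwa [Complex.norm_real, Real.norm_of_nonneg hq0.le]
  set E := Complex.exp ((Real.log x) * Complex.log z / (Real.log q))
  set y := -(q : ℂ) / ((x : ℂ) * z) with hy
  have hmul : PhiSW q z (q * x) = z * E * onePhiOne q (1 / z) ((q : ℂ)⁻¹ * y) := by
    have he : ((Real.log (q * x) : ℝ) : ℂ) * Complex.log z / (Real.log q) =
        Complex.log z + (Real.log x) * Complex.log z / (Real.log q) := by
      rw [Real.log_mul hq0.ne' hx.ne', Complex.ofReal_add]
      field_simp
    have ha : -(q : ℂ) / (((q * x : ℝ) : ℂ) * z) = (q : ℂ)⁻¹ * y := by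
      rw [hy, Complex.ofReal_mul]
      field_simp
    rw [PhiSW, he, ha, Complex.exp_add, Complex.exp_log hz0]
  have hdiv : PhiSW q z (x / q) = z⁻¹ * E * onePhiOne q (1 / z) (q * y) := by
    have he : ((Real.log (x / q) : ℝ) : ℂ) * Complex.log z / (Real.log q) =
        -Complex.log z + (Real.log x) * Complex.log z / (Real.log q) := by
      rw [Real.log_div hx.ne' hq0.ne', Complex.ofReal_sub]
      field_simp
      ring
    have ha : -(q : ℂ) / (((x / q : ℝ) : ℂ) * z) = q * y := by
      rw [hy, Complex.ofReal_div]
      field_simp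
    rw [PhiSW, he, ha, Complex.exp_add, Complex.exp_neg, Complex.exp_log hz0]
  have hself : PhiSW q z x = E * onePhiOne q (1 / z) y := rfl
  have hyq : -(y / q) = 1 / (x * z) := by
    rw [hy]
    field_simp
  have key := onePhiOne_q_difference hqc hnorm (1 / z) y
  rw [hyq, sub_eq_iff_eq_add] at key
  rw [hmul, hdiv, hself, key]
  field_simp
  ring
end

section
/- Fix t > 0. Let J be the unbounded operator on the Hilbert space ℓ²(ℤ;ℂ) whose domain 𝒟 is the subspace of finitely supported sequences, defined by (Jv)_k = a_{k-1}·v_{k-1} + b_k·v_k + a_k·v_{k+1} for k ∈ ℤ, where a_k = (t q^{k+1})^{-1/2} and b_k = -(t q^k)^{-1}. Then (J, 𝒟) is a densely defined symmetric operator, and it is essentially self-adjoint: its adjoint J* is a self-adjoint operator (equivalently, the adjoint of J is symmetric, equivalently the closure of J is self-adjoint). -/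
open MeasureTheory
open Filter Topology ComplexConjugate

namespace GeometricJacobi

theorem tendsto_coord_cofinite_zero {ι : Type*} (v : lp (fun _ : ι => ℂ) 2) :
    Tendsto (fun k => v k) cofinite (𝓝 0) := by
  have h := (lp.summable_inner (𝕜 := ℂ) v v).tendsto_cofinite_zero
  simp only [inner_self_eq_norm_sq_to_K] at h
  rw [tendsto_zero_iff_norm_tendsto_zero] at h ⊢
  simpa [Real.sqrt_sq] using h.sqrt

theorem dense_of_finite_support_mem {ι : Type*} {p : Submodule ℂ (lp (fun _ : ι => ℂ) 2)}
    (hp : ∀ v : lp (fun _ : ι => ℂ) 2, (Function.support fun k => v k).Finite → v ∈ p) :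
    Dense (p : Set (lp (fun _ : ι => ℂ) 2)) := by
  classical
  intro v
  refine mem_closure_of_tendsto (lp.hasSum_single (by norm_num) v)
    (Eventually.of_forall fun s => p.sum_mem fun i _ => hp _ ?_)
  refine (Set.finite_singleton i).subset fun k hk => ?_
  by_contra h
  exact hk (lp.single_apply_ne _ _ _ h)

theorem tendsto_zpow_atTop_zero {q : ℝ} (h0 : 0 ≤ q) (h1 : q < 1) :
    Tendsto (fun k : ℤ => q ^ k) atTop (𝓝 0) := by
  rw [← Nat.map_cast_int_atTop, tendsto_map'_iff]
  simpa [Function.comp_def] using tendsto_pow_atTop_nhds_zero_of_lt_one h0 h1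

theorem tendsto_zpow_atBot_atTop {q : ℝ} (h0 : 0 < q) (h1 : q < 1) :
    Tendsto (fun k : ℤ => q ^ k) atBot atTop := by
  have h : Tendsto (fun k : ℤ => q ^ k) atTop (𝓝[>] 0) := tendsto_nhdsWithin_iff.mpr
    ⟨tendsto_zpow_atTop_zero h0.le h1, Eventually.of_forall fun k => zpow_pos h0 k⟩
  simpa [Function.comp_def, zpow_neg] using
    tendsto_inv_nhdsGT_zero.comp (h.comp tendsto_neg_atBot_atTop)

/-- The pointwise action of the Jacobi recurrence whose coefficients are `a (k - 1) = s k` and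
`b k = -(s k) ^ 2`. -/
def recurrence (s : ℤ → ℝ) (v : ℤ → ℂ) (k : ℤ) : ℂ :=
  s k * v (k - 1) - s k ^ 2 * v k + s (k + 1) * v (k + 1)

variable {s : ℤ → ℝ} {r : ℝ}

theorem tendsto_mul_self (hpos : ∀ k, 0 < s k) (hr : ∀ k, s (k + 1) = r * s k)
    (htop : Tendsto s atTop atTop) (hbot : Tendsto s atBot (𝓝 0))
    (u f : lp (fun _ : ℤ => ℂ) 2) (hf : ∀ k, f k = recurrence s u k) :
    Tendsto (fun k => (s k : ℂ) * u k) cofinite (𝓝 0) := by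
  have hu := tendsto_coord_cofinite_zero u
  have hf0 := tendsto_coord_cofinite_zero f
  have hsucc : Tendsto (fun k : ℤ => u (k + 1)) cofinite (𝓝 0) :=
    hu.comp (add_left_injective (1 : ℤ)).tendsto_cofinite
  have hpred : Tendsto (fun k : ℤ => u (k - 1)) cofinite (𝓝 0) :=
    hu.comp (sub_left_injective (b := (1 : ℤ))).tendsto_cofinite
  rw [Int.cofinite_eq] at *
  rw [tendsto_sup] at *
  constructor
  · have hs : Tendsto (fun k => (s k : ℂ)) atBot (𝓝 0) := by
      exact_mod_cast (Complex.continuous_ofReal.tendsto 0).comp hbot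
    simpa using hs.mul hu.1
  · have hs : Tendsto (fun k => ((s k)⁻¹ : ℂ)) atTop (𝓝 0) := by
      simpa [Function.comp_def] using
        (Complex.continuous_ofReal.tendsto 0).comp htop.inv_tendsto_atTop
    have h := (hpred.2.add (hsucc.2.const_mul (r : ℂ))).sub (hs.mul hf0.2)
    simp only [mul_zero, add_zero, sub_zero] at h
    refine h.congr fun k => ?_
    have hk : (s k : ℂ) ≠ 0 := by exact_mod_cast (hpos k).ne'
    rw [hf, recurrence, hr]
    push_cast
    field_simp
    ring

theorem inner_recurrence_left (hpos : ∀ k, 0 < s k) (hr : ∀ k, s (k + 1) = r * s k)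
    (htop : Tendsto s atTop atTop) (hbot : Tendsto s atBot (𝓝 0))
    {u f v g : lp (fun _ : ℤ => ℂ) 2} (hf : ∀ k, f k = recurrence s u k)
    (hg : ∀ k, g k = recurrence s v k) : inner ℂ f v = inner ℂ u g := by
  set W : ℤ → ℂ := fun k => s k * (conj (u (k - 1)) * v k - conj (u k) * v (k - 1)) with hW
  have hW0 : Tendsto W cofinite (𝓝 0) := by
    have hu := tendsto_mul_self hpos hr htop hbot u f hf
    have hv := tendsto_mul_self hpos hr htop hbot v g hg
    have hpred : Tendsto (fun k : ℤ => k - 1) cofinite cofinite :=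
      (sub_left_injective (b := (1 : ℤ))).tendsto_cofinite
    have hu1 := (tendsto_coord_cofinite_zero u).comp hpred
    have hv1 := (tendsto_coord_cofinite_zero v).comp hpred
    have h := ((Complex.continuous_conj.tendsto _).comp hu1 |>.mul hv).sub
      (((Complex.continuous_conj.tendsto _).comp hu).mul hv1)
    simp only [map_zero, mul_zero, sub_zero] at h
    refine h.congr fun k => ?_
    simp only [Function.comp_apply, hW, map_mul, Complex.conj_ofReal]
    ring
  have hdiff : ∀ k, inner ℂ (f k) (v k) - inner ℂ (u k) (g k) = W k - W (k + 1) := by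
    intro k
    simp only [RCLike.inner_apply', hf, hg, recurrence, hW, map_add, map_sub, map_mul, map_pow,
      Complex.conj_ofReal, add_sub_cancel_right]
    ring
  have hsum : HasSum (fun k => W k - W (k + 1)) (inner ℂ f v - inner ℂ u g) := by
    simpa only [hdiff] using (lp.hasSum_inner (𝕜 := ℂ) f v).sub (lp.hasSum_inner u g)
  rw [Int.cofinite_eq, tendsto_sup] at hW0
  have hlim : Tendsto (fun n : ℕ => W (-n) - W n) atTop (𝓝 0) := by
    simpa using (hW0.1.comp (tendsto_neg_atTop_atBot.comp tendsto_natCast_atTop_atTop)).sub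
      (hW0.2.comp (tendsto_natCast_atTop_atTop (R := ℤ)))
  have hsymm : HasSum (fun k => W k - W (k + 1)) 0 (SummationFilter.symmetricIco ℤ) := by
    rw [SummationFilter.hasSum_symmetricIco_int_iff]
    simpa only [Finset.sum_Ico_int_sub] using hlim
  exact sub_eq_zero.mp (HasSum.unique (L := SummationFilter.symmetricIco ℤ)
    (hsum.mono_left SummationFilter.le_atTop) hsymm)

theorem adjoint_apply_coord (J : (lp (fun _ : ℤ => ℂ) 2) →ₗ.[ℂ] (lp (fun _ : ℤ => ℂ) 2))
    (hdense : Dense (J.domain : Set (lp (fun _ : ℤ => ℂ) 2)))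
    (hdom : ∀ v : lp (fun _ : ℤ => ℂ) 2,
      (Function.support fun k : ℤ => v k).Finite → v ∈ J.domain)
    (hact : ∀ (v : J.domain) (k : ℤ),
      (J v) k = recurrence s (v : lp (fun _ : ℤ => ℂ) 2) k)
    (y : J.adjoint.domain) (k : ℤ) :
    (J.adjoint y) k = recurrence s (y : lp (fun _ : ℤ => ℂ) 2) k := by
  have he : lp.single 2 k (1 : ℂ) ∈ J.domain := by
    refine hdom _ ((Set.finite_singleton k).subset fun j hj => ?_)
    by_contra h
    exact hj (lp.single_apply_ne _ _ _ h)
  have hJe : J ⟨lp.single 2 k (1 : ℂ), he⟩ = lp.single 2 (k - 1) (s k : ℂ)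
      - lp.single 2 k ((s k : ℂ) ^ 2) + lp.single 2 (k + 1) (s (k + 1) : ℂ) := by
    ext j
    rw [hact]
    simp only [recurrence, lp.coeFn_add, lp.coeFn_sub, Pi.add_apply, Pi.sub_apply, lp.single_apply,
      Pi.single_apply]
    grind
  have h := LinearPMap.adjoint_isFormalAdjoint hdense y ⟨lp.single 2 k (1 : ℂ), he⟩
  rw [hJe, inner_add_right, inner_sub_right] at h
  simp only [lp.inner_single_right, RCLike.inner_apply'] at h
  apply (starRingEnd ℂ).injective
  simp only [recurrence, map_add, map_sub, map_mul, map_pow, Complex.conj_ofReal]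
  linear_combination h

theorem isSelfAdjoint_adjoint_of_isFormalAdjoint {E : Type*} [NormedAddCommGroup E]
    [InnerProductSpace ℂ E] [CompleteSpace E] {T : E →ₗ.[ℂ] E}
    (hdense : Dense (T.domain : Set E)) (hT : T.IsFormalAdjoint T)
    (hT' : T.adjoint.IsFormalAdjoint T.adjoint) : IsSelfAdjoint T.adjoint := by
  have hle : T ≤ T.adjoint := hT.le_adjoint hdense
  have hdense' : Dense (T.adjoint.domain : Set E) := hdense.mono hle.1
  rw [LinearPMap.isSelfAdjoint_def]
  refine le_antisymm (LinearPMap.IsFormalAdjoint.le_adjoint hdense fun x y => ?_)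
    (hT'.le_adjoint hdense')
  rw [LinearPMap.apply_comp_inclusion hle x]
  exact (LinearPMap.adjoint_isFormalAdjoint hdense').symm (Submodule.inclusion hle.1 x) y

end GeometricJacobi

/-- for `0 < q < 1` and `t > 0`, the doubly infinite Jacobi operator `J` on
`ℓ²(ℤ;ℂ)` with domain `𝒟` the finitely supported sequences, defined by
`(Jv)_k = a_{k-1} v_{k-1} + b_k v_k + a_k v_{k+1}` where `a_k = (t q^{k+1})^{-1/2}` and
`b_k = -(t q^k)^{-1}`, exists; it is a densely defined symmetric operator and it is
essentially self-adjoint: its adjoint `J†` is a self-adjoint operator. -/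
theorem jacobi_operator_essentially_selfAdjoint (q : ℝ) (hq0 : 0 < q) (hq1 : q < 1)
    (t : ℝ) (ht : 0 < t)
    (J : (lp (fun _ : ℤ => ℂ) 2) →ₗ.[ℂ] (lp (fun _ : ℤ => ℂ) 2))
    (hdom : ∀ v : lp (fun _ : ℤ => ℂ) 2,
      v ∈ J.domain ↔ (Function.support fun k : ℤ => v k).Finite)
    (hact : ∀ v : J.domain, ∀ k : ℤ,
      (J v) k = ((1 / Real.sqrt (t * q ^ k) : ℝ) : ℂ) * (v : lp (fun _ : ℤ => ℂ) 2) (k - 1)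
        + ((-1 / (t * q ^ k) : ℝ) : ℂ) * (v : lp (fun _ : ℤ => ℂ) 2) k
        + ((1 / Real.sqrt (t * q ^ (k + 1)) : ℝ) : ℂ) * (v : lp (fun _ : ℤ => ℂ) 2) (k + 1)) :
    Dense (J.domain : Set (lp (fun _ : ℤ => ℂ) 2)) ∧
    (∀ u v : J.domain, @inner ℂ _ _ (J u) (v : lp (fun _ : ℤ => ℂ) 2)
      = @inner ℂ _ _ (u : lp (fun _ : ℤ => ℂ) 2) (J v)) ∧
    IsSelfAdjoint J.adjoint := by
  set s : ℤ → ℝ := fun k => 1 / √(t * q ^ k) with hs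
  have hx : ∀ k : ℤ, 0 < t * q ^ k := fun k => mul_pos ht (zpow_pos hq0 k)
  have hpos : ∀ k, 0 < s k := fun k => one_div_pos.mpr (Real.sqrt_pos.mpr (hx k))
  have hr : ∀ k, s (k + 1) = 1 / √q * s k := fun k => by
    simp only [hs]
    rw [zpow_add_one₀ hq0.ne', ← mul_assoc, Real.sqrt_mul (hx k).le]
    field_simp
  have htop : Tendsto s atTop atTop := by
    have h0 : Tendsto (fun k : ℤ => √(t * q ^ k)) atTop (𝓝 0) := by
      simpa using ((GeometricJacobi.tendsto_zpow_atTop_zero hq0.le hq1).const_mul t).sqrt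
    simpa [hs, Function.comp_def] using tendsto_inv_nhdsGT_zero.comp
      (tendsto_nhdsWithin_iff.mpr
        ⟨h0, Eventually.of_forall fun k => Real.sqrt_pos.mpr (hx k)⟩)
  have hbot : Tendsto s atBot (𝓝 0) := by
    have h1 := (GeometricJacobi.tendsto_zpow_atBot_atTop hq0 hq1).const_mul_atTop ht
    simpa [hs, Function.comp_def] using
      tendsto_inv_atTop_zero.comp (Real.tendsto_sqrt_atTop.comp h1)
  have hrec : ∀ (v : J.domain) (k : ℤ),
      (J v) k = GeometricJacobi.recurrence s (v : lp (fun _ : ℤ => ℂ) 2) k := fun v k => by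
    have hb : -1 / (t * q ^ k) = -(s k) ^ 2 := by
      simp only [hs]
      rw [div_pow, Real.sq_sqrt (hx k).le, one_pow, neg_div]
    rw [hact, hb, GeometricJacobi.recurrence]
    simp only [hs]
    push_cast
    ring
  have hdense := GeometricJacobi.dense_of_finite_support_mem fun v => (hdom v).mpr
  have hadj := GeometricJacobi.adjoint_apply_coord J hdense (fun v => (hdom v).mpr) hrec
  have hsymm : J.IsFormalAdjoint J := fun u v =>
    GeometricJacobi.inner_recurrence_left hpos hr htop hbot (hrec u) (hrec v)
  exact ⟨hdense, hsymm, GeometricJacobi.isSelfAdjoint_adjoint_of_isFormalAdjoint hdense hsymm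
    fun u v => GeometricJacobi.inner_recurrence_left hpos hr htop hbot (hadj u) (hadj v)⟩
end

section
/- Fix t > 0 and let a_k = (t q^{k+1})^{-1/2}, b_k = -(t q^k)^{-1} for k ∈ ℤ. If v : ℤ → ℂ satisfies the three-term recurrence a_k·v_{k+1} + b_k·v_k + a_{k-1}·v_{k-1} = 0 for all k ∈ ℤ and Σ_{k∈ℤ} |v_k|² < ∞, then v_k = 0 for all k ∈ ℤ. (In particular, 0 is not an eigenvalue of the self-adjoint closure of the associated doubly infinite Jacobi operator.) -/
/-- A bounded two-sided sequence with `‖v_{k+1}‖ ≤ c_k ‖v_k‖ + d ‖v_{k-1}‖` vanishes up to index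
`K + 1` when `c_k + d ≤ ρ < 1` for all `k ≤ K`. -/
theorem eq_zero_of_bounded_of_contracting_recurrence {E : Type*} [NormedAddCommGroup E]
    {v : ℤ → E} {c : ℤ → ℝ} {d B ρ : ℝ} {K : ℤ} (hd : 0 ≤ d) (hc : ∀ k, 0 ≤ c k) (hρ1 : ρ < 1)
    (hrec : ∀ k, ‖v (k + 1)‖ ≤ c k * ‖v k‖ + d * ‖v (k - 1)‖)
    (hK : ∀ k ≤ K, c k + d ≤ ρ) (hB : ∀ k, ‖v k‖ ≤ B) :
    ∀ k ≤ K + 1, v k = 0 := by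
  have hB0 : 0 ≤ B := (norm_nonneg _).trans (hB 0)
  have hρ0 : 0 ≤ ρ := (add_nonneg (hc K) hd).trans (hK K le_rfl)
  have decay : ∀ n : ℕ, ∀ k ≤ K + 1, ‖v k‖ ≤ ρ ^ n * B := by
    intro n
    induction n with
    | zero => intro k _; simpa using hB k
    | succ n ih =>
      intro k hk
      have h := hrec (k - 1)
      rw [sub_add_cancel] at h
      calc ‖v k‖ ≤ c (k - 1) * ‖v (k - 1)‖ + d * ‖v (k - 1 - 1)‖ := h
        _ ≤ c (k - 1) * (ρ ^ n * B) + d * (ρ ^ n * B) := by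
          gcongr
          · exact hc _
          · exact ih _ (by lia)
          · exact ih _ (by lia)
        _ = (c (k - 1) + d) * (ρ ^ n * B) := by ring
        _ ≤ ρ * (ρ ^ n * B) := by
          gcongr
          exact hK _ (by lia)
        _ = ρ ^ (n + 1) * B := by ring
  intro k hk
  have hlim := (tendsto_pow_atTop_nhds_zero_of_lt_one hρ0 hρ1).mul_const B
  rw [zero_mul] at hlim
  exact norm_le_zero_iff.mp (ge_of_tendsto' hlim fun n => decay n k hk)

/-- for `0 < q < 1` and `t > 0`, with Jacobi coefficients
`a_k = (t q^{k+1})^{-1/2}` and `b_k = -(t q^k)^{-1}`, every square-summable solution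
`v : ℤ → ℂ` of the recurrence `a_k v_{k+1} + b_k v_k + a_{k-1} v_{k-1} = 0` vanishes
identically; in particular `0` is not an eigenvalue of the self-adjoint closure of the
associated doubly infinite Jacobi operator. -/
theorem jacobi_recurrence_no_l2_solution (q : ℝ) (hq0 : 0 < q) (hq1 : q < 1)
    (t : ℝ) (ht : 0 < t) (v : ℤ → ℂ)
    (hrec : ∀ k : ℤ,
      ((1 / Real.sqrt (t * q ^ (k + 1)) : ℝ) : ℂ) * v (k + 1)
        + ((-1 / (t * q ^ k) : ℝ) : ℂ) * v k
        + ((1 / Real.sqrt (t * q ^ k) : ℝ) : ℂ) * v (k - 1) = 0)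
    (hl2 : Summable fun k : ℤ => ‖v k‖ ^ 2) :
    ∀ k : ℤ, v k = 0 := by
  set s : ℤ → ℝ := fun k => Real.sqrt (t * q ^ k) with hs
  have spos : ∀ k, 0 < s k := fun k => Real.sqrt_pos.mpr (mul_pos ht (zpow_pos hq0 k))
  have hr0 : 0 < Real.sqrt q := Real.sqrt_pos.mpr hq0
  have hr1 : Real.sqrt q < 1 := by rw [Real.sqrt_lt' one_pos]; simpa using hq1
  set r := Real.sqrt q with hr
  have s_succ : ∀ k, s (k + 1) = r * s k := by
    intro k
    simp only [hs, hr]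
    rw [zpow_add_one₀ hq0.ne', ← Real.sqrt_mul hq0.le]
    congr 1
    ring
  have s_sq : ∀ k, t * q ^ k = s k * s k := fun k =>
    (Real.mul_self_sqrt (mul_pos ht (zpow_pos hq0 k)).le).symm
  have v_succ : ∀ k, v (k + 1) = ((r / s k : ℝ) : ℂ) * v k - (r : ℂ) * v (k - 1) := by
    intro k
    have h := hrec k
    change ((1 / s (k + 1) : ℝ) : ℂ) * v (k + 1) + ((-1 / (t * q ^ k) : ℝ) : ℂ) * v k
      + ((1 / s k : ℝ) : ℂ) * v (k - 1) = 0 at h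
    rw [s_succ, s_sq] at h
    have h1 : (s k : ℂ) ≠ 0 := by exact_mod_cast (spos k).ne'
    have h2 : (r : ℂ) ≠ 0 := by exact_mod_cast hr0.ne'
    push_cast at h ⊢
    field_simp at h ⊢
    linear_combination h
  have norm_v_succ : ∀ k, ‖v (k + 1)‖ ≤ r / s k * ‖v k‖ + r * ‖v (k - 1)‖ := by
    intro k
    rw [v_succ]
    refine (norm_sub_le _ _).trans_eq ?_
    rw [norm_mul, norm_mul, Complex.norm_of_nonneg (div_pos hr0 (spos k)).le,
      Complex.norm_of_nonneg hr0.le]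
  have bounded : ∀ k, ‖v k‖ ≤ Real.sqrt (∑' j, ‖v j‖ ^ 2) := fun k =>
    Real.le_sqrt_of_sq_le (hl2.le_tsum k fun j _ => sq_nonneg _)
  obtain ⟨K, hK⟩ : ∃ K : ℤ, ∀ k ≤ K, r / s k + r ≤ (1 + r) / 2 := by
    have hδ : 0 < (1 - r) / 2 := by linarith
    obtain ⟨n, hn⟩ := exists_pow_lt_of_lt_one
      (mul_pos ht (pow_pos (div_pos hδ hr0) 2)) hq1
    refine ⟨-n, fun k hk => ?_⟩
    have hqk : (q ^ n)⁻¹ ≤ q ^ k := by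
      rw [← zpow_natCast, ← zpow_neg]
      exact zpow_le_zpow_right_of_le_one₀ hq0 hq1.le hk
    have hsk : r / ((1 - r) / 2) ≤ s k := by
      refine Real.le_sqrt_of_sq_le (le_trans ?_ (mul_le_mul_of_nonneg_left hqk ht.le))
      rw [← div_eq_mul_inv, le_div_iff₀ (pow_pos hq0 n)]
      calc (r / ((1 - r) / 2)) ^ 2 * q ^ n
          ≤ (r / ((1 - r) / 2)) ^ 2 * (t * ((1 - r) / 2 / r) ^ 2) := by gcongr
        _ = t := by
          have : 1 - r ≠ 0 := (sub_pos.mpr hr1).ne'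
          field_simp
    have : r / s k ≤ (1 - r) / 2 := by
      rw [div_le_iff₀ hδ] at hsk
      rw [div_le_iff₀ (spos k)]
      linarith
    linarith
  have left_zero := eq_zero_of_bounded_of_contracting_recurrence hr0.le
    (fun k => (div_pos hr0 (spos k)).le) (by linarith) norm_v_succ hK bounded
  have right_zero : ∀ k, K ≤ k → v k = 0 ∧ v (k + 1) = 0 := by
    intro k hk
    induction k, hk using Int.leInduction with
    | base => exact ⟨left_zero _ (by lia), left_zero _ le_rfl⟩
    | succ k _ ih => exact ⟨ih.2, by rw [v_succ, add_sub_cancel_right, ih.1, ih.2]; simp⟩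
  intro k
  rcases le_total k K with h | h
  · exact left_zero k (by lia)
  · exact (right_zero k h).1
end

section
/- Fix t > 0. Define the q-Fibonacci sequence (F_k)_{k≥0} by F_0 = 0, F_1 = 1 and F_{k+1} = F_k - t q^{k-1} F_{k-1} for k ≥ 1. Then for every k ≥ 1, F_{k+1} = Σ_{n=0}^{k-1} [k-n choose n]_q·(-1)^n·q^{n²}·t^n, where [m choose n]_q = (q;q)_m/((q;q)_n (q;q)_{m-n}) for 0 ≤ n ≤ m and [m choose n]_q = 0 for n > m, and F_k converges as k → ∞ to φ_0(t) = Σ_{n=0}^∞ (-1)^n q^{n²} t^n/(q;q)_n. -/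
open Finset Filter

/-- The real q-Pochhammer symbol `(a;q)_n = ∏_{j=0}^{n-1} (1 - a q^j)`. -/
noncomputable def qPochR (q a : ℝ) (n : ℕ) : ℝ :=
  ∏ j ∈ Finset.range n, (1 - a * q ^ j)

/-- The q-binomial coefficient `[m choose n]_q`, set to `0` for `n > m`. -/
noncomputable def qBinom (q : ℝ) (m n : ℕ) : ℝ :=
  if n ≤ m then qPochR q q m / (qPochR q q n * qPochR q q (m - n)) else 0

/-- The Rogers--Ramanujan entire function `φ₀(t) = Σ_{n=0}^∞ (-1)^n q^{n²} t^n/(q;q)_n`. -/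
noncomputable def phiZero (q t : ℝ) : ℝ :=
  ∑' n : ℕ, (-1) ^ n * q ^ (n ^ 2) * t ^ n / qPochR q q n

lemma qPochR_self_pos {q : ℝ} (hq0 : 0 < q) (hq1 : q < 1) (n : ℕ) : 0 < qPochR q q n := by
  refine Finset.prod_pos fun j _ => ?_
  rw [← pow_succ']
  exact sub_pos.2 (pow_lt_one₀ hq0.le hq1 j.succ_ne_zero)

lemma qPochR_self_succ (q : ℝ) (n : ℕ) :
    qPochR q q (n + 1) = qPochR q q n * (1 - q ^ (n + 1)) := by
  rw [qPochR, Finset.prod_range_succ, ← pow_succ', qPochR]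

lemma qBinom_of_lt (q : ℝ) {m n : ℕ} (h : m < n) : qBinom q m n = 0 :=
  if_neg h.not_ge

lemma qBinom_zero_right {q : ℝ} (hq0 : 0 < q) (hq1 : q < 1) (m : ℕ) : qBinom q m 0 = 1 := by
  have := (qPochR_self_pos hq0 hq1 m).ne'
  have h0 : qPochR q q 0 = 1 := Finset.prod_range_zero _
  simp [qBinom, h0, this]

/-- The q-Pascal rule. -/
lemma qBinom_succ_succ {q : ℝ} (hq0 : 0 < q) (hq1 : q < 1) {m n : ℕ} (h : n ≤ m) :
    qBinom q (m + 1) (n + 1) = qBinom q m (n + 1) + q ^ (m - n) * qBinom q m n := by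
  have hpos := fun i => (qPochR_self_pos hq0 hq1 i).ne'
  obtain ⟨d, rfl⟩ := Nat.exists_eq_add_of_le h
  have hfac := fun i : ℕ => (sub_pos.2 (pow_lt_one₀ hq0.le hq1 i.succ_ne_zero)).ne'
  have hn := hfac n
  have hn0 := hpos n
  cases d with
  | zero =>
    rw [qBinom_of_lt q (by omega : n + 0 < n + 1)]
    have h0 : qPochR q q 0 = 1 := Finset.prod_range_zero _
    have hn1 := hpos (n + 1)
    simp [qBinom, h0, hn0, hn1]
  | succ d =>
    have hd := hfac d
    have hd0 := hpos d
    have e1 : n + (d + 1) + 1 - (n + 1) = d + 1 := by omega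
    have e2 : n + (d + 1) - (n + 1) = d := by omega
    have e3 : n + (d + 1) - n = d + 1 := by omega
    rw [qBinom, qBinom, qBinom, if_pos (by omega), if_pos (by omega), if_pos (by omega), e1, e2, e3,
      qPochR_self_succ q (n + (d + 1)), qPochR_self_succ q n, qPochR_self_succ q d]
    simp only [Nat.succ_eq_add_one] at hn hd
    field_simp
    ring

lemma qBinom_add_left {q : ℝ} (hq0 : 0 < q) (hq1 : q < 1) (a n : ℕ) :
    qBinom q (a + n) n = (∏ j ∈ Finset.range n, (1 - q * q ^ (a + j))) / qPochR q q n := by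
  have ha := (qPochR_self_pos hq0 hq1 a).ne'
  have hn := (qPochR_self_pos hq0 hq1 n).ne'
  rw [qBinom, if_pos (Nat.le_add_left n a), Nat.add_sub_cancel, qPochR, Finset.prod_range_add,
    ← qPochR]
  field_simp

lemma abs_qBinom_le {q : ℝ} (hq0 : 0 < q) (hq1 : q < 1) (m n : ℕ) :
    |qBinom q m n| ≤ 1 / qPochR q q n := by
  have hn := qPochR_self_pos hq0 hq1 n
  rcases lt_or_ge m n with h | h
  · rw [qBinom_of_lt q h, abs_zero]
    positivity
  · obtain ⟨a, rfl⟩ := Nat.exists_eq_add_of_le' h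
    have hfac : ∀ i : ℕ, 0 ≤ 1 - q * q ^ i := fun i => by
      rw [← pow_succ']
      exact sub_nonneg.2 (pow_le_one₀ hq0.le hq1.le)
    have hprod := Finset.prod_nonneg fun j (_ : j ∈ Finset.range n) => hfac (a + j)
    rw [qBinom_add_left hq0 hq1, abs_of_nonneg (div_nonneg hprod hn.le)]
    gcongr
    refine Finset.prod_le_one (fun j _ => hfac _) fun j _ => ?_
    linarith [mul_pos hq0 (pow_pos hq0 (a + j))]

lemma tendsto_qBinom_sub {q : ℝ} (hq0 : 0 < q) (hq1 : q < 1) (n : ℕ) :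
    Tendsto (fun k => qBinom q (k - n) n) atTop (nhds (1 / qPochR q q n)) := by
  rw [← tendsto_add_atTop_iff_nat (n + n)]
  have e : ∀ a, a + (n + n) - n = a + n := fun a => by omega
  simp only [e, qBinom_add_left hq0 hq1]
  refine Tendsto.div_const ?_ _
  have hfac : ∀ j ∈ Finset.range n,
      Tendsto (fun a : ℕ => 1 - q * q ^ (a + j)) atTop (nhds 1) := fun j _ => by
    have h := (tendsto_add_atTop_iff_nat j).2 (tendsto_pow_atTop_nhds_zero_of_lt_one hq0.le hq1)
    simpa using (h.const_mul q).const_sub 1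
  simpa using tendsto_finsetProd _ hfac

lemma summable_pow_sq_mul_div_qPochR {q : ℝ} (hq0 : 0 < q) (hq1 : q < 1) {t : ℝ} (ht : 0 < t) :
    Summable fun n : ℕ => q ^ (n ^ 2) * t ^ n / qPochR q q n := by
  have hpos := qPochR_self_pos hq0 hq1
  refine summable_of_ratio_test_tendsto_lt_one zero_lt_one
    (Eventually.of_forall fun n => ?_) ?_
  · have := hpos n
    positivity
  have hratio : ∀ n : ℕ, ‖q ^ ((n + 1) ^ 2) * t ^ (n + 1) / qPochR q q (n + 1)‖ /
      ‖q ^ (n ^ 2) * t ^ n / qPochR q q n‖ = q ^ n * q ^ (n + 1) * t / (1 - q ^ (n + 1)) := by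
    intro n
    have h1 := hpos n
    have h2 := hpos (n + 1)
    have h3 : 0 < 1 - q ^ (n + 1) := sub_pos.2 (pow_lt_one₀ hq0.le hq1 n.succ_ne_zero)
    rw [Real.norm_of_nonneg (by positivity), Real.norm_of_nonneg (by positivity),
      qPochR_self_succ]
    field_simp
    ring
  simp only [hratio]
  have h0 := tendsto_pow_atTop_nhds_zero_of_lt_one hq0.le hq1
  have h1 := (tendsto_add_atTop_iff_nat 1).2 h0
  simpa [Pi.div_def] using ((h0.mul h1).mul_const t).div (h1.const_sub 1) (by norm_num)

lemma sum_qBinom_recurrence {q : ℝ} (hq0 : 0 < q) (hq1 : q < 1) (t : ℝ) (k : ℕ) :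
    ∑ n ∈ Finset.range (k + 3), qBinom q (k + 2 - n) n * (-1) ^ n * q ^ (n ^ 2) * t ^ n =
      ∑ n ∈ Finset.range (k + 2), qBinom q (k + 1 - n) n * (-1) ^ n * q ^ (n ^ 2) * t ^ n -
      t * q ^ (k + 1) *
        ∑ n ∈ Finset.range (k + 1), qBinom q (k - n) n * (-1) ^ n * q ^ (n ^ 2) * t ^ n := by
  have hlast : qBinom q (k + 2 - (k + 1 + 1)) (k + 1 + 1) = 0 := qBinom_of_lt q (by omega)
  rw [Finset.sum_range_succ, Finset.sum_range_succ' _ (k + 1), Finset.sum_range_succ' _ (k + 1),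
    hlast, qBinom_zero_right hq0 hq1, qBinom_zero_right hq0 hq1, Finset.mul_sum]
  have hterm : ∀ n ∈ Finset.range (k + 1),
      qBinom q (k + 2 - (n + 1)) (n + 1) * (-1) ^ (n + 1) * q ^ ((n + 1) ^ 2) * t ^ (n + 1) =
      qBinom q (k + 1 - (n + 1)) (n + 1) * (-1) ^ (n + 1) * q ^ ((n + 1) ^ 2) * t ^ (n + 1) -
      t * q ^ (k + 1) * (qBinom q (k - n) n * (-1) ^ n * q ^ (n ^ 2) * t ^ n) := by
    intro n hn
    have hnk : n ≤ k := Nat.lt_succ_iff.1 (Finset.mem_range.1 hn)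
    have e1 : k + 2 - (n + 1) = k - n + 1 := by omega
    have e2 : k + 1 - (n + 1) = k - n := by omega
    rw [e1, e2]
    rcases le_or_gt n (k - n) with h | h
    · have hpow : q ^ (k + 1) * q ^ (n ^ 2) = q ^ (k - n - n) * q ^ ((n + 1) ^ 2) := by
        rw [← pow_add, ← pow_add]
        congr 1
        have : k = k - n - n + 2 * n := by omega
        nlinarith
      rw [qBinom_succ_succ hq0 hq1 h]
      linear_combination t * qBinom q (k - n) n * (-1) ^ n * t ^ n * hpow
    · rw [qBinom_of_lt q (by omega : k - n + 1 < n + 1), qBinom_of_lt q (by omega : k - n < n + 1),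
        qBinom_of_lt q h]
      ring
  rw [Finset.sum_congr rfl hterm, Finset.sum_sub_distrib]
  ring

lemma tendsto_sum_qBinom {q : ℝ} (hq0 : 0 < q) (hq1 : q < 1) {t : ℝ} (ht : 0 < t) :
    Tendsto (fun k : ℕ => ∑ n ∈ Finset.range (k + 1),
      qBinom q (k - n) n * (-1) ^ n * q ^ (n ^ 2) * t ^ n) atTop (nhds (phiZero q t)) := by
  have htsum : ∀ k : ℕ, ∑ n ∈ Finset.range (k + 1),
      qBinom q (k - n) n * (-1) ^ n * q ^ (n ^ 2) * t ^ n =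
      ∑' n : ℕ, qBinom q (k - n) n * (-1) ^ n * q ^ (n ^ 2) * t ^ n := fun k => by
    refine (tsum_eq_sum fun n hn => ?_).symm
    rw [Finset.mem_range] at hn
    rw [qBinom_of_lt q (by omega)]
    ring
  simp only [htsum]
  refine tendsto_tsum_of_dominated_convergence (summable_pow_sq_mul_div_qPochR hq0 hq1 ht)
    (fun n => ?_) (Eventually.of_forall fun k n => ?_)
  · convert (((tendsto_qBinom_sub hq0 hq1 n).mul_const ((-1) ^ n)).mul_const
      (q ^ (n ^ 2))).mul_const (t ^ n) using 2
    ring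
  · have hbound := mul_le_mul_of_nonneg_right (abs_qBinom_le hq0 hq1 (k - n) n)
      (by positivity : 0 ≤ q ^ (n ^ 2) * t ^ n)
    have hnorm : ‖qBinom q (k - n) n * (-1) ^ n * q ^ (n ^ 2) * t ^ n‖ =
        |qBinom q (k - n) n| * (q ^ (n ^ 2) * t ^ n) := by
      simp [abs_of_pos hq0, abs_of_pos ht, mul_assoc]
    rw [hnorm]
    exact hbound.trans_eq (by ring)

/-- the q-Fibonacci sequence `F_0 = 0`, `F_1 = 1`,
`F_{k+1} = F_k - t q^{k-1} F_{k-1}` satisfies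
`F_{k+1} = Σ_{n=0}^{k-1} [k-n choose n]_q (-1)^n q^{n²} t^n` for `k ≥ 1`,
and `F_k → φ₀(t)` as `k → ∞`. -/
theorem qFibonacci_formula_and_limit (q : ℝ) (hq0 : 0 < q) (hq1 : q < 1)
    (t : ℝ) (ht : 0 < t) (F : ℕ → ℝ) (hF0 : F 0 = 0) (hF1 : F 1 = 1)
    (hFrec : ∀ k : ℕ, 1 ≤ k → F (k + 1) = F k - t * q ^ (k - 1) * F (k - 1)) :
    (∀ k : ℕ, 1 ≤ k →
      F (k + 1) = ∑ n ∈ Finset.range k, qBinom q (k - n) n * (-1) ^ n * q ^ (n ^ 2) * t ^ n) ∧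
    Tendsto F atTop (nhds (phiZero q t)) := by
  have hF : ∀ k : ℕ, F (k + 1) =
      ∑ n ∈ Finset.range (k + 1), qBinom q (k - n) n * (-1) ^ n * q ^ (n ^ 2) * t ^ n := by
    intro k
    induction k using Nat.twoStepInduction with
    | zero => simp [hF1, qBinom_zero_right hq0 hq1]
    | one =>
      rw [hFrec 1 le_rfl, Finset.sum_range_succ, qBinom_of_lt q (by omega : 1 - 1 < 1)]
      simp [hF0, hF1, qBinom_zero_right hq0 hq1]
    | more k ih1 ih2 =>
      rw [sum_qBinom_recurrence hq0 hq1, ← ih1, ← ih2]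
      exact hFrec (k + 2) (by omega)
  refine ⟨fun k hk => ?_, ?_⟩
  · rw [hF, Finset.sum_range_succ, qBinom_of_lt q (by omega : k - k < k)]
    ring
  · rw [← tendsto_add_atTop_iff_nat 1]
    simpa only [hF] using tendsto_sum_qBinom hq0 hq1 ht
end
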